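/- Let α,β>−1 and let X be a Banach space. There exists a constant c>0, depending only on α and β, such that for every exponent 1≤p<∞, every n∈ℕ and every X-valued polynomial q∈Π_{2n}(X), one has c^{−1}·(∑_{j=1}^{n+1} λ_j ‖q(t_j)‖^p)^{1/p} ≤ (∫_{−1}^{1} ‖q(t)‖^p w_{α,β}(t) dt)^{1/p}, where t_1>⋯>t_{n+1} are the zeros of p_{n+1}^{(α,β)} and λ_1,…,λ_{n+1} the corresponding Gaussian quadrature weights. -/

import Mathlib

open MeasureTheory Set Filter

/-- The Jacobi weight `w_{α,β}(t) = (1-t)^α (1+t)^β`. -/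
noncomputable def jacobiWeight (α β : ℝ) (t : ℝ) : ℝ := (1 - t) ^ α * (1 + t) ^ β

/-- The system of `L₂(I, w_{α,β})`-normalized Jacobi polynomials: real polynomials
`P n` of degree `n` with positive leading coefficient which are orthonormal with
respect to the weight `w_{α,β}` on `I = (-1,1)`. -/
structure JacobiSystem (α β : ℝ) where
  P : ℕ → Polynomial ℝ
  natDegree_eq : ∀ n, (P n).natDegree = n
  leadingCoeff_pos : ∀ n, 0 < (P n).leadingCoeff
  orthonormal : ∀ n m, (∫ t in Ioo (-1:ℝ) 1,
      (P n).eval t * (P m).eval t * jacobiWeight α β t) = if n = m then 1 else 0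

/-- For each `n`, the zeros `t_1 > ⋯ > t_{n+1}` of `p_{n+1}^{(α,β)}` (all in `I`)
together with the Gaussian quadrature weights `λ_1, …, λ_{n+1} > 0`, characterized by
exactness of the quadrature formula on polynomials of degree `≤ 2n+1`. -/
structure JacobiNodes {α β : ℝ} (J : JacobiSystem α β) where
  node : (n : ℕ) → Fin (n + 1) → ℝ
  wt : (n : ℕ) → Fin (n + 1) → ℝ
  node_mem : ∀ n j, node n j ∈ Ioo (-1:ℝ) 1
  node_strictAnti : ∀ n, StrictAnti (node n)
  node_isZero : ∀ n j, (J.P (n + 1)).eval (node n j) = 0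
  wt_pos : ∀ n j, 0 < wt n j
  quadrature : ∀ (n : ℕ) (q : Polynomial ℝ), q.natDegree ≤ 2 * n + 1 →
    (∫ t in Ioo (-1:ℝ) 1, q.eval t * jacobiWeight α β t)
      = ∑ j : Fin (n + 1), wt n j * q.eval (node n j)

section

open Real Polynomial

/-- Trigonometric polynomials of degree at most `m`. -/
noncomputable def trigSpan (m : ℕ) : Submodule ℂ (ℝ → ℂ) :=
  Submodule.span ℂ {f | ∃ l : ℤ, |l| ≤ m ∧ f = fun φ : ℝ => Complex.exp (l * φ * Complex.I)}

theorem trigSpan_mono {m k : ℕ} (h : m ≤ k) : trigSpan m ≤ trigSpan k := by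
  refine Submodule.span_mono ?_
  rintro f ⟨l, hl, rfl⟩
  exact ⟨l, hl.trans (by exact_mod_cast h), rfl⟩

theorem mul_mem_trigSpan {m k : ℕ} {f g : ℝ → ℂ} (hf : f ∈ trigSpan m) (hg : g ∈ trigSpan k) :
    f * g ∈ trigSpan (m + k) := by
  have h := Submodule.mul_mem_mul hf hg
  rw [trigSpan, trigSpan, Submodule.span_mul_span] at h
  refine Submodule.span_mono ?_ h
  rintro _ ⟨_, ⟨l, hl, rfl⟩, _, ⟨l', hl', rfl⟩, rfl⟩
  refine ⟨l + l', (abs_add_le l l').trans (by push_cast; exact add_le_add hl hl'), ?_⟩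
  funext φ
  simp only [Pi.mul_apply, ← Complex.exp_add]
  push_cast
  ring_nf

theorem one_mem_trigSpan (m : ℕ) : (1 : ℝ → ℂ) ∈ trigSpan m :=
  Submodule.subset_span ⟨0, by simp, by funext φ; simp⟩

theorem pow_mem_trigSpan {f : ℝ → ℂ} (hf : f ∈ trigSpan 1) (k : ℕ) : f ^ k ∈ trigSpan k := by
  induction k with
  | zero => simpa using one_mem_trigSpan 0
  | succ k ih => rw [pow_succ]; exact mul_mem_trigSpan ih hf

theorem cos_sub_mem_trigSpan (θ : ℝ) :
    (fun φ : ℝ => ((Real.cos (θ - φ) : ℝ) : ℂ)) ∈ trigSpan 1 := by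
  have h1 : (fun φ : ℝ => Complex.exp ((1 : ℤ) * φ * Complex.I)) ∈ trigSpan 1 :=
    Submodule.subset_span ⟨1, by simp, rfl⟩
  have h2 : (fun φ : ℝ => Complex.exp ((-1 : ℤ) * φ * Complex.I)) ∈ trigSpan 1 :=
    Submodule.subset_span ⟨-1, by simp, rfl⟩
  have h := add_mem ((trigSpan 1).smul_mem (Complex.exp (-(θ * Complex.I)) / 2) h1)
    ((trigSpan 1).smul_mem (Complex.exp (θ * Complex.I) / 2) h2)
  convert h using 1
  funext φ
  simp only [Complex.ofReal_cos, Complex.cos, Pi.add_apply, Pi.smul_apply, smul_eq_mul,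
    div_mul_eq_mul_div, ← Complex.exp_add]
  push_cast
  ring_nf

theorem eval_cos_sub_mem_trigSpan (P : ℝ[X]) {m : ℕ} (hP : P.natDegree ≤ m) (θ : ℝ) :
    (fun φ : ℝ => ((P.eval (Real.cos (θ - φ)) : ℝ) : ℂ)) ∈ trigSpan m := by
  have h : (fun φ : ℝ => ((P.eval (Real.cos (θ - φ)) : ℝ) : ℂ)) =
      ∑ i ∈ Finset.range (P.natDegree + 1), (P.coeff i : ℂ) •
        (fun φ : ℝ => ((Real.cos (θ - φ) : ℝ) : ℂ)) ^ i := by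
    funext φ
    rw [eval_eq_sum_range]
    simp
  rw [h]
  refine Submodule.sum_mem _ fun i hi => Submodule.smul_mem _ _ ?_
  exact trigSpan_mono ((Finset.mem_range_succ_iff.1 hi).trans hP)
    (pow_mem_trigSpan (cos_sub_mem_trigSpan θ) i)

/-- The Dirichlet kernel. -/
noncomputable def dirichletKernel (m : ℕ) (ψ : ℝ) : ℂ :=
  ∑ l ∈ Finset.Icc (-m : ℤ) m, Complex.exp (l * ψ * Complex.I)

theorem continuous_dirichletKernel (m : ℕ) : Continuous (dirichletKernel m) := by
  unfold dirichletKernel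
  fun_prop

theorem norm_dirichletKernel_le (m : ℕ) (ψ : ℝ) : ‖dirichletKernel m ψ‖ ≤ 2 * m + 1 := by
  refine (norm_sum_le _ _).trans ?_
  have : ∀ l ∈ Finset.Icc (-m : ℤ) m, ‖Complex.exp (l * ψ * Complex.I)‖ ≤ 1 := by
    intro l _
    have := Complex.norm_exp_ofReal_mul_I (l * ψ)
    push_cast at this
    exact this.le
  refine (Finset.sum_le_card_nsmul _ _ _ this).trans ?_
  rw [Int.card_Icc]
  have : ((m : ℤ) + 1 - -m).toNat = 2 * m + 1 := by omega
  rw [this]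
  simp

/-- A `2π / M`-periodic cutoff supported where `cos (M φ) ≤ 0`. -/
noncomputable def cutoff (M : ℕ) (φ : ℝ) : ℝ := max 0 (-Real.cos (M * φ))

theorem continuous_cutoff (M : ℕ) : Continuous (cutoff M) := by
  unfold cutoff
  fun_prop

theorem cutoff_nonneg (M : ℕ) (φ : ℝ) : 0 ≤ cutoff M φ := le_max_left _ _

theorem cutoff_le_one (M : ℕ) (φ : ℝ) : cutoff M φ ≤ 1 :=
  max_le zero_le_one (by linarith [Real.neg_one_le_cos (M * φ)])

theorem cutoff_neg (M : ℕ) (φ : ℝ) : cutoff M (-φ) = cutoff M φ := by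
  simp [cutoff]

theorem integral_exp_mul_cutoff {M : ℕ} {l : ℤ} (hl : l ≠ 0) (hM : |l| < M) :
    ∫ φ in -π..π, Complex.exp (l * φ * Complex.I) * cutoff M φ = 0 := by
  have hM0 : (M : ℝ) ≠ 0 := by
    rintro h
    have : M = 0 := by exact_mod_cast h
    subst this
    have := abs_nonneg l
    simp at hM
    omega
  set g : ℝ → ℂ := fun φ => Complex.exp (l * φ * Complex.I) * cutoff M φ with hg
  have hper : Function.Periodic g (2 * π) := by
    intro φ
    simp only [hg, cutoff]
    have h1 : (M : ℝ) * (φ + 2 * π) = M * φ + M * (2 * π) := by ring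
    rw [h1, Real.cos_add_nat_mul_two_pi]
    congr 1
    rw [Complex.exp_eq_exp_iff_exists_int]
    exact ⟨l, by push_cast; ring⟩
  have hshift : ∀ φ, g (φ + 2 * π / M) = Complex.exp (l * (2 * π / M) * Complex.I) * g φ := by
    intro φ
    simp only [hg, cutoff]
    have h1 : (M : ℝ) * (φ + 2 * π / M) = M * φ + 2 * π := by field_simp
    rw [h1, Real.cos_add_two_pi, ← mul_assoc, ← Complex.exp_add]
    congr 2
    push_cast
    ring
  have h1 : ∫ φ in -π..π, g φ = ∫ φ in -π..π, g (φ + 2 * π / M) := by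
    rw [intervalIntegral.integral_comp_add_right]
    have := hper.intervalIntegral_add_eq (-π) (-π + 2 * π / M)
    convert this using 2 <;> ring
  have h2 : ∫ φ in -π..π, g φ
      = Complex.exp (l * (2 * π / M) * Complex.I) * ∫ φ in -π..π, g φ := by
    rw [← intervalIntegral.integral_const_mul, h1]
    exact intervalIntegral.integral_congr fun φ _ => hshift φ
  have hne : Complex.exp (l * (2 * π / M) * Complex.I) ≠ 1 := by
    intro h
    obtain ⟨k, hk⟩ := Complex.exp_eq_one_iff.1 h
    have hM0' : (M : ℂ) ≠ 0 := by exact_mod_cast hM0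
    have hpi : (π : ℂ) ≠ 0 := by exact_mod_cast Real.pi_ne_zero
    have h3 : (l : ℂ) = k * M := by
      field_simp at hk
      linear_combination hk
    have h6 : l = k * M := by exact_mod_cast h3
    have hk0 : k ≠ 0 := by rintro rfl; simp at h6; exact hl h6
    rw [h6, abs_mul, Nat.abs_cast] at hM
    have : 1 ≤ |k| := Int.one_le_abs hk0
    nlinarith [this, hM, (Nat.cast_nonneg M : (0 : ℤ) ≤ M)]
  have h3 : (1 - Complex.exp (l * (2 * π / M) * Complex.I)) * ∫ φ in -π..π, g φ = 0 := by
    linear_combination h2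
  rcases mul_eq_zero.1 h3 with h4 | h4
  · exact absurd (by linear_combination -h4) hne
  · exact h4

theorem integral_cutoff_ge {M : ℕ} (hM : M ≠ 0) : 1 ≤ ∫ φ in -π..π, cutoff M φ := by
  have hM0 : (M : ℝ) ≠ 0 := by exact_mod_cast hM
  have h1 : ∀ φ, (Real.cos (M * φ) ^ 2 - Real.cos (M * φ)) / 2 ≤ cutoff M φ := by
    intro φ
    have h1 := Real.neg_one_le_cos (M * φ)
    have h2 := Real.cos_le_one (M * φ)
    rcases le_total 0 (Real.cos (M * φ)) with h | h
    · exact le_trans (by nlinarith) (cutoff_nonneg M φ)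
    · exact le_trans (by nlinarith) (le_max_right _ _)
  have h2 : ∫ φ in -π..π, (Real.cos (M * φ) ^ 2 - Real.cos (M * φ)) / 2 = π / 2 := by
    have := intervalIntegral.integral_comp_mul_left (a := -π) (b := π)
      (fun x => (Real.cos x ^ 2 - Real.cos x) / 2) hM0
    rw [this, intervalIntegral.integral_div, intervalIntegral.integral_sub, integral_cos_sq,
      integral_cos]
    · simp [Real.sin_nat_mul_pi]
      field_simp
    all_goals exact Continuous.intervalIntegrable (by fun_prop) _ _
  calc (1 : ℝ) ≤ π / 2 := by linarith [Real.two_le_pi]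
    _ = _ := h2.symm
    _ ≤ _ := intervalIntegral.integral_mono_on (by linarith [Real.pi_pos])
        (Continuous.intervalIntegrable (by fun_prop) _ _)
        ((continuous_cutoff M).intervalIntegrable _ _) fun φ _ => h1 φ

theorem integral_dirichletKernel_cutoff {m M : ℕ} (hM : 2 * m < M) (θ : ℝ) {f : ℝ → ℂ}
    (hf : f ∈ trigSpan m) :
    ∫ φ in -π..π, f φ * (dirichletKernel m (θ - φ) * cutoff M φ)
      = (∫ φ in -π..π, cutoff M φ : ℝ) * f θ := by
  have hk : Continuous fun φ => dirichletKernel m (θ - φ) * (cutoff M φ : ℂ) := by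
    have := continuous_dirichletKernel m
    have := continuous_cutoff M
    fun_prop
  suffices h : Continuous f ∧ ∫ φ in -π..π, f φ * (dirichletKernel m (θ - φ) * cutoff M φ)
      = (∫ φ in -π..π, cutoff M φ : ℝ) * f θ from h.2
  induction hf using Submodule.span_induction with
  | mem f hf =>
    obtain ⟨l, hl, rfl⟩ := hf
    refine ⟨by fun_prop, ?_⟩
    have h1 : ∀ φ : ℝ, Complex.exp (l * φ * Complex.I) *
        (dirichletKernel m (θ - φ) * cutoff M φ) = ∑ k ∈ Finset.Icc (-m : ℤ) m,
          Complex.exp (k * θ * Complex.I) *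
            (Complex.exp ((l - k : ℤ) * φ * Complex.I) * cutoff M φ) := by
      intro φ
      rw [dirichletKernel, Finset.sum_mul, Finset.mul_sum]
      refine Finset.sum_congr rfl fun k _ => ?_
      rw [← mul_assoc, ← mul_assoc, ← Complex.exp_add, ← Complex.exp_add]
      congr 2
      push_cast
      ring
    have hc := continuous_cutoff M
    simp_rw [h1]
    rw [intervalIntegral.integral_finsetSum
      fun k _ => Continuous.intervalIntegrable (by fun_prop) _ _]
    rw [Finset.sum_eq_single l]
    · rw [intervalIntegral.integral_const_mul, mul_comm]
      congr 1
      simp [intervalIntegral.integral_ofReal]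
    · intro k hk hkl
      rw [intervalIntegral.integral_const_mul, integral_exp_mul_cutoff (by omega), mul_zero]
      rw [Finset.mem_Icc] at hk
      rw [abs_le] at hl
      rw [abs_lt]
      omega
    · intro h
      rw [Finset.mem_Icc, ← abs_le] at h
      exact absurd hl h
  | zero => exact ⟨continuous_zero, by simp⟩
  | add f g _ _ hf hg =>
    refine ⟨hf.1.add hg.1, ?_⟩
    simp only [Pi.add_apply, add_mul]
    have h := intervalIntegral.integral_add ((hf.1.mul hk).intervalIntegrable (μ := volume) (-π) π)
      ((hg.1.mul hk).intervalIntegrable (-π) π)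
    simp only [Pi.mul_apply] at h
    rw [h, hf.2, hg.2]
    ring
  | smul a f _ hf =>
    refine ⟨hf.1.const_smul a, ?_⟩
    simp only [Pi.smul_apply, smul_eq_mul, mul_assoc]
    rw [intervalIntegral.integral_const_mul, hf.2]
    ring

theorem integral_reproducing (P r : ℝ[X]) {n : ℕ} (hP : P.natDegree ≤ 2 * n) (hP1 : P.eval 1 = 1)
    (hr : r.natDegree ≤ 2 * n) (θ : ℝ) :
    ∫ φ in -π..π, P.eval (cos (θ - φ)) * (dirichletKernel (4 * n) (θ - φ)).re *
        cutoff (10 * (n + 1)) φ * r.eval (cos φ)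
      = (∫ φ in -π..π, cutoff (10 * (n + 1)) φ) * r.eval (cos θ) := by
  have hr' := eval_cos_sub_mem_trigSpan r hr 0
  have hP' := eval_cos_sub_mem_trigSpan P hP θ
  have h := mul_mem_trigSpan hr' hP'
  rw [show 2 * n + 2 * n = 4 * n by ring] at h
  have h2 := integral_dirichletKernel_cutoff (M := 10 * (n + 1)) (by omega) θ h
  have hD := continuous_dirichletKernel (4 * n)
  have hc := continuous_cutoff (10 * (n + 1))
  have h3 := congrArg Complex.re h2
  simp only [Pi.mul_apply, zero_sub, cos_neg, sub_self, cos_zero, hP1, Complex.ofReal_one,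
    mul_one, ← Complex.ofReal_mul, Complex.ofReal_re] at h3
  rw [← h3, intervalIntegral.integral_of_le (by linarith [pi_pos]),
    intervalIntegral.integral_of_le (by linarith [pi_pos])]
  have hInt : IntegrableOn (fun φ : ℝ => ((r.eval (cos φ) * P.eval (cos (θ - φ)) : ℝ) : ℂ) *
      (dirichletKernel (4 * n) (θ - φ) * cutoff (10 * (n + 1)) φ)) (Ioc (-π) π) := by
    refine Continuous.integrableOn_Ioc ?_
    fun_prop
  have h4 := integral_re hInt
  simp only [RCLike.re_eq_complex_re] at h4
  rw [← h4]
  congr 1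
  funext φ
  rw [Complex.re_ofReal_mul, Complex.re_mul_ofReal]
  ring

theorem norm_le_integral_cutoff {X : Type*} [NormedAddCommGroup X] [NormedSpace ℝ X]
    [CompleteSpace X] (x : ℕ → X) (P : ℝ[X]) {n : ℕ} (hP : P.natDegree ≤ 2 * n)
    (hP1 : P.eval 1 = 1) (hP0 : ∀ t, 0 ≤ P.eval t) (θ : ℝ) :
    ‖∑ k ∈ Finset.range (2 * n + 1), cos θ ^ k • x k‖ ≤
      ∫ φ in 0..π, ‖∑ k ∈ Finset.range (2 * n + 1), cos φ ^ k • x k‖ *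
        (8 * (n + 1) * cutoff (10 * (n + 1)) φ *
          (P.eval (cos (θ - φ)) + P.eval (cos (θ + φ)))) := by
  set q : ℝ → X := fun φ => ∑ k ∈ Finset.range (2 * n + 1), cos φ ^ k • x k with hq
  set K : ℝ → ℝ := fun φ => P.eval (cos (θ - φ)) * (dirichletKernel (4 * n) (θ - φ)).re *
        cutoff (10 * (n + 1)) φ with hK
  set c := ∫ φ in -π..π, cutoff (10 * (n + 1)) φ with hc
  have hc1 : 1 ≤ c := integral_cutoff_ge (by omega)
  have hDc := continuous_dirichletKernel (4 * n)
  have hcc := continuous_cutoff (10 * (n + 1))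
  have hKc : Continuous K := by
    have := Complex.continuous_re.comp hDc
    simp only [hK]
    fun_prop
  have hqc : Continuous q := by simp only [hq]; fun_prop
  have h1 : ∫ φ in -π..π, K φ • q φ = c • q θ := by
    simp only [hq, Finset.smul_sum, smul_smul]
    rw [intervalIntegral.integral_finsetSum
      fun k _ => Continuous.intervalIntegrable (by fun_prop) _ _]
    refine Finset.sum_congr rfl fun k hk => ?_
    rw [intervalIntegral.integral_smul_const]
    congr 1
    have := integral_reproducing P (Polynomial.X ^ k) hP hP1
      (by rw [natDegree_X_pow]; exact Finset.mem_range_succ_iff.1 hk) θ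
    simpa using this
  have hb : ∀ φ, ‖K φ • q φ‖ ≤ 8 * (n + 1) * cutoff (10 * (n + 1)) φ *
      P.eval (cos (θ - φ)) * ‖q φ‖ := by
    intro φ
    rw [norm_smul]
    refine mul_le_mul_of_nonneg_right ?_ (norm_nonneg _)
    simp only [hK, norm_mul, Real.norm_eq_abs, abs_of_nonneg (hP0 _),
      abs_of_nonneg (cutoff_nonneg _ _)]
    have h2 : |(dirichletKernel (4 * n) (θ - φ)).re| ≤ 8 * (n + 1) := by
      refine (Complex.abs_re_le_norm _).trans ((norm_dirichletKernel_le _ _).trans ?_)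
      push_cast
      linarith
    have h3 := mul_le_mul_of_nonneg_left h2
      (mul_nonneg (hP0 (cos (θ - φ))) (cutoff_nonneg (10 * (n + 1)) φ))
    linarith
  set g : ℝ → ℝ := fun φ => 8 * (n + 1) * cutoff (10 * (n + 1)) φ *
      P.eval (cos (θ - φ)) * ‖q φ‖ with hg
  have hgc : Continuous g := by simp only [hg]; fun_prop
  have h2 : c * ‖q θ‖ ≤ ∫ φ in -π..π, g φ := by
    have : c * ‖q θ‖ = ‖∫ φ in -π..π, K φ • q φ‖ := by
      rw [h1, norm_smul, Real.norm_of_nonneg (by linarith)]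
    rw [this]
    exact intervalIntegral.norm_integral_le_of_norm_le (by linarith [pi_pos])
      (Eventually.of_forall fun φ _ => hb φ) (hgc.intervalIntegrable _ _)
  have h3 : ∫ φ in -π..π, g φ = ∫ φ in 0..π, (g φ + g (-φ)) := by
    rw [intervalIntegral.integral_add (hgc.intervalIntegrable _ _)
      ((by fun_prop : Continuous fun φ => g (-φ)).intervalIntegrable _ _), intervalIntegral.integral_comp_neg,
      neg_zero, add_comm]
    exact (intervalIntegral.integral_add_adjacent_intervals (hgc.intervalIntegrable _ _)
      (hgc.intervalIntegrable _ _)).symm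
  have h4 : ‖q θ‖ ≤ c * ‖q θ‖ := le_mul_of_one_le_left (norm_nonneg _) hc1
  refine h4.trans (h2.trans (h3.le.trans (le_of_eq ?_)))
  refine intervalIntegral.integral_congr fun φ _ => ?_
  simp only [hg, hq, cutoff_neg, cos_neg, sub_neg_eq_add]
  ring

theorem exists_symmetrized (P : ℝ[X]) (φ : ℝ) : ∃ Q : ℝ[X], Q.natDegree ≤ P.natDegree ∧
    ∀ θ, Q.eval (cos θ) = P.eval (cos (θ - φ)) + P.eval (cos (θ + φ)) := by
  have hmon : ∀ k : ℕ, ∃ Q : ℝ[X], Q.natDegree ≤ k ∧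
      ∀ θ, Q.eval (cos θ) = cos (θ - φ) ^ k + cos (θ + φ) ^ k := by
    intro k
    induction k using Nat.twoStepInduction with
    | zero => exact ⟨C 2, by simp, fun θ => by simp; norm_num⟩
    | one =>
      refine ⟨C (2 * cos φ) * X, by compute_degree, fun θ => ?_⟩
      simp [cos_sub, cos_add]
      ring
    | more k h0 h1 =>
      obtain ⟨Q0, hd0, h0⟩ := h0
      obtain ⟨Q1, hd1, h1⟩ := h1
      refine ⟨C (2 * cos φ) * X * Q1 - (X ^ 2 - C (sin φ ^ 2)) * Q0, ?_, fun θ => ?_⟩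
      · have h2 : (C (2 * cos φ) * X * Q1).natDegree ≤ k + 2 :=
          natDegree_mul_le.trans (by
            have : (C (2 * cos φ) * X).natDegree ≤ 1 := by compute_degree
            omega)
        have h3 : ((X ^ 2 - C (sin φ ^ 2)) * Q0).natDegree ≤ k + 2 :=
          natDegree_mul_le.trans (by
            have : (X ^ 2 - C (sin φ ^ 2)).natDegree ≤ 2 := by compute_degree
            omega)
        exact (natDegree_sub_le _ _).trans (max_le h2 h3)
      · simp only [eval_sub, eval_mul, eval_C, eval_X, eval_pow, h0, h1]
        have e1 : cos (θ - φ) + cos (θ + φ) = 2 * cos φ * cos θ := by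
          rw [cos_sub, cos_add]; ring
        have e2 : cos (θ - φ) * cos (θ + φ) = cos θ ^ 2 - sin φ ^ 2 := by
          rw [cos_sub, cos_add]
          linear_combination cos θ ^ 2 * sin_sq_add_cos_sq φ - sin φ ^ 2 * sin_sq_add_cos_sq θ
        rw [← e1, ← e2]
        ring
  choose Q hd hQ using hmon
  refine ⟨∑ k ∈ Finset.range (P.natDegree + 1), C (P.coeff k) * Q k, ?_, fun θ => ?_⟩
  · refine natDegree_sum_le_of_forall_le _ _ fun k hk => ?_
    exact (natDegree_C_mul_le _ _).trans ((hd k).trans (Finset.mem_range_succ_iff.1 hk))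
  · rw [eval_finsetSum, eval_eq_sum_range, eval_eq_sum_range, ← Finset.sum_add_distrib]
    refine Finset.sum_congr rfl fun k _ => ?_
    rw [eval_mul, eval_C, hQ]
    ring

/-- The Dirichlet kernel of order `k` as a polynomial in `cos ψ`. -/
noncomputable def dirichletPoly (k : ℕ) : ℝ[X] :=
  1 + ∑ j ∈ Finset.range k, C 2 * Polynomial.Chebyshev.T ℝ ((j + 1 : ℕ) : ℤ)

theorem natDegree_dirichletPoly_le (k : ℕ) : (dirichletPoly k).natDegree ≤ k := by
  refine (natDegree_add_le _ _).trans (max_le (by simp) ?_)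
  refine natDegree_sum_le_of_forall_le _ _ fun j hj => ?_
  refine (natDegree_C_mul_le _ _).trans ?_
  rw [Polynomial.Chebyshev.natDegree_T]
  have := Finset.mem_range.1 hj
  omega

theorem eval_dirichletPoly (k : ℕ) (ψ : ℝ) : (dirichletPoly k).eval (cos ψ) =
    1 + ∑ j ∈ Finset.range k, 2 * cos ((j + 1 : ℕ) * ψ) := by
  simp only [dirichletPoly, eval_add, eval_one, eval_finsetSum, eval_mul, eval_C,
    Polynomial.Chebyshev.T_real_cos, Int.cast_natCast]

theorem eval_one_dirichletPoly (k : ℕ) : (dirichletPoly k).eval 1 = 2 * k + 1 := by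
  rw [← cos_zero, eval_dirichletPoly]
  simp
  ring

theorem abs_eval_dirichletPoly_le (k : ℕ) (ψ : ℝ) :
    |(dirichletPoly k).eval (cos ψ)| ≤ 2 * k + 1 := by
  rw [eval_dirichletPoly]
  refine (abs_add_le _ _).trans ?_
  have h : |∑ j ∈ Finset.range k, 2 * cos ((j + 1 : ℕ) * ψ)| ≤ ∑ j ∈ Finset.range k, (2 : ℝ) := by
    refine (Finset.abs_sum_le_sum_abs _ _).trans (Finset.sum_le_sum fun j _ => ?_)
    rw [abs_mul, abs_two]
    linarith [abs_cos_le_one ((j + 1 : ℕ) * ψ)]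
  simp only [Finset.sum_const, Finset.card_range, nsmul_eq_mul] at h
  rw [abs_one]
  linarith

theorem eval_dirichletPoly_mul_sin (k : ℕ) (ψ : ℝ) :
    (dirichletPoly k).eval (cos ψ) * sin (ψ / 2) = sin ((k + 1 / 2) * ψ) := by
  rw [eval_dirichletPoly]
  induction k with
  | zero => simp; ring_nf
  | succ k ih =>
    rw [Finset.sum_range_succ, ← add_assoc, add_mul, ih]
    have h1 : ((k : ℝ) + 1 / 2) * ψ = (k + 1 : ℕ) * ψ - ψ / 2 := by push_cast; ring
    have h2 : (((k + 1 : ℕ) : ℝ) + 1 / 2) * ψ = (k + 1 : ℕ) * ψ + ψ / 2 := by ring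
    rw [h1, h2, sin_sub, sin_add]
    ring

/-- Existence of nonnegative algebraic polynomials in `cos ψ` of degree at most `2 n`, normalized
at `ψ = 0` and decaying like `(1 + n |ψ|) ^ (-2 L)`. -/
theorem exists_localized_polynomial {L : ℕ} (hL : 1 ≤ L) (n : ℕ) : ∃ P : ℝ[X],
    P.natDegree ≤ 2 * n ∧ P.eval 1 = 1 ∧ (∀ t, 0 ≤ P.eval t) ∧
    ∀ ψ, P.eval (cos ψ) ≤ (2 * L / (1 + (n + 1) * |sin (ψ / 2)|)) ^ (2 * L) := by
  set k := n / L with hk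
  have hk0 : (0 : ℝ) < 2 * k + 1 := by positivity
  refine ⟨(C ((2 * k + 1 : ℝ)⁻¹) * dirichletPoly k) ^ (2 * L), ?_, ?_, ?_, ?_⟩
  · refine natDegree_pow_le.trans ?_
    have h1 := (natDegree_C_mul_le ((2 * k + 1 : ℝ)⁻¹) (dirichletPoly k)).trans
      (natDegree_dirichletPoly_le k)
    have h2 : L * (n / L) ≤ n := Nat.mul_div_le n L
    calc _ ≤ 2 * L * k := Nat.mul_le_mul_left _ h1
      _ = 2 * (L * (n / L)) := by rw [hk]; ring
      _ ≤ _ := by omega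
  · simp only [eval_pow, eval_mul, eval_C, eval_one_dirichletPoly]
    rw [inv_mul_cancel₀ hk0.ne', one_pow]
  · intro t
    rw [eval_pow]
    exact (even_two_mul L).pow_nonneg _
  · intro ψ
    simp only [eval_pow, eval_mul, eval_C]
    rw [← (even_two_mul L).pow_abs]
    refine pow_le_pow_left₀ (abs_nonneg _) ?_ _
    have h1 := abs_eval_dirichletPoly_le k ψ
    have h2 := congrArg abs (eval_dirichletPoly_mul_sin k ψ)
    rw [abs_mul] at h2
    have h3 := abs_sin_le_one ((k + 1 / 2) * ψ)
    have hL' : (1 : ℝ) ≤ L := by exact_mod_cast hL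
    have h4 : (n : ℝ) + 1 ≤ L * (2 * k + 1) := by
      have : n < L * (n / L) + L := by
        have := Nat.div_add_mod n L
        have := Nat.mod_lt n (by omega : 0 < L)
        omega
      rw [← hk] at this
      have h5 : ((n + 1 : ℕ) : ℝ) ≤ ((L * k + L : ℕ) : ℝ) := by exact_mod_cast this
      push_cast at h5
      nlinarith [(by positivity : (0 : ℝ) ≤ L * k)]
    set s := |sin (ψ / 2)|
    have hs : 0 ≤ s := abs_nonneg _
    have hn : (0 : ℝ) < 1 + (n + 1) * s := by positivity
    rw [abs_mul, abs_of_pos (inv_pos.2 hk0), inv_mul_eq_div, div_le_div_iff₀ hk0 hn]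
    set D := |(dirichletPoly k).eval (cos ψ)|
    have hD : 0 ≤ D := abs_nonneg _
    have h5 : D * ((n + 1) * s) ≤ L * (2 * k + 1) := by
      calc D * ((n + 1) * s) = (D * s) * (n + 1) := by ring
        _ ≤ 1 * (n + 1) := by
            refine mul_le_mul_of_nonneg_right ?_ (by positivity)
            rw [h2]; exact h3
        _ ≤ _ := by linarith
    nlinarith

theorem integral_inv_one_add_abs_sin_sq_le {ν : ℝ} (hν : 0 < ν) {φ : ℝ} (hφ : φ ∈ Icc 0 π) :
    ∫ θ in 0..π, ν * ((1 + ν * |sin ((θ - φ) / 2)|) ^ 2)⁻¹ ≤ π ^ 2 := by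
  have hpos : ∀ θ : ℝ, 0 < (1 + ν * |sin ((θ - φ) / 2)|) ^ 2 := fun θ => by positivity
  have hpos' : ∀ x : ℝ, 1 + x ^ 2 ≠ 0 := fun x => by positivity
  calc ∫ θ in 0..π, ν * ((1 + ν * |sin ((θ - φ) / 2)|) ^ 2)⁻¹
      ≤ ∫ θ in 0..π, ν * (1 + (ν / π * θ - ν / π * φ) ^ 2)⁻¹ := by
        refine intervalIntegral.integral_mono_on pi_pos.le
          (Continuous.intervalIntegrable ?_ _ _) (Continuous.intervalIntegrable ?_ _ _) ?_
        · exact continuous_const.mul (Continuous.inv₀ (by fun_prop) fun θ => (hpos θ).ne')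
        · exact continuous_const.mul (Continuous.inv₀ (by fun_prop) fun θ => hpos' _)
        · intro θ hθ
          refine mul_le_mul_of_nonneg_left (inv_anti₀ (by positivity) ?_) hν.le
          have h1 : 2 / π * |(θ - φ) / 2| ≤ |sin ((θ - φ) / 2)| := by
            refine mul_abs_le_abs_sin ?_
            rw [abs_le]
            constructor <;> linarith [hθ.1, hθ.2, hφ.1, hφ.2]
          have h2 : ν / π * |θ - φ| ≤ ν * |sin ((θ - φ) / 2)| := by
            calc ν / π * |θ - φ| = ν * (2 / π * |(θ - φ) / 2|) := by
                  rw [abs_div, abs_two]; field_simp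
              _ ≤ _ := mul_le_mul_of_nonneg_left h1 hν.le
          have h3 : (ν / π * θ - ν / π * φ) ^ 2 = (ν / π * |θ - φ|) ^ 2 := by
            rw [mul_pow, sq_abs]; ring
          have h4 : 0 ≤ ν / π * |θ - φ| := by positivity
          rw [h3]
          nlinarith
    _ = π * (arctan (ν / π * π - ν / π * φ) - arctan (ν / π * 0 - ν / π * φ)) := by
        rw [intervalIntegral.integral_const_mul,
          intervalIntegral.integral_comp_mul_sub (fun x => (1 + x ^ 2)⁻¹)
            (div_ne_zero hν.ne' pi_ne_zero), integral_inv_one_add_sq, smul_eq_mul]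
        field_simp
    _ ≤ π * π := by
        refine mul_le_mul_of_nonneg_left ?_ pi_pos.le
        linarith [arctan_lt_pi_div_two (ν / π * π - ν / π * φ),
          neg_pi_div_two_lt_arctan (ν / π * 0 - ν / π * φ)]
    _ = π ^ 2 := by ring

theorem integral_inv_sq_mul_sin_rpow_le {ν : ℝ} (hν : 1 ≤ ν) {γ : ℝ} (hγ0 : 0 ≤ γ) (hγ1 : γ < 1)
    {φ : ℝ} (hφ : φ ∈ Icc 0 π) :
    IntervalIntegrable (fun θ => ν * ((1 + ν * |sin ((θ - φ) / 2)|) ^ 2)⁻¹ *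
      (ν * sin (θ / 2)) ^ (-γ)) volume 0 π ∧
    ∫ θ in 0..π, ν * ((1 + ν * |sin ((θ - φ) / 2)|) ^ 2)⁻¹ * (ν * sin (θ / 2)) ^ (-γ)
      ≤ π / (1 - γ) + π ^ 2 := by
  have hν0 : 0 < ν := by linarith
  have hpos : ∀ θ : ℝ, 0 < (1 + ν * |sin ((θ - φ) / 2)|) ^ 2 := fun θ => by positivity
  set f : ℝ → ℝ := fun θ => ν * ((1 + ν * |sin ((θ - φ) / 2)|) ^ 2)⁻¹ with hf
  have hfc : Continuous f :=
    continuous_const.mul (Continuous.inv₀ (by fun_prop) fun θ => (hpos θ).ne')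
  have hf0 : ∀ θ, 0 ≤ f θ := fun θ => by simp only [hf]; positivity
  have hfν : ∀ θ, f θ ≤ ν := fun θ => by
    refine mul_le_of_le_one_right hν0.le (inv_le_one_of_one_le₀ ?_)
    have : 0 ≤ ν * |sin ((θ - φ) / 2)| := by positivity
    nlinarith
  have hA : ∀ θ, 0 ≤ θ → θ ≤ π → ν / π * θ ≤ ν * sin (θ / 2) := fun θ h0 h1 => by
    have := mul_le_sin (x := θ / 2) (by linarith) (by linarith)
    calc ν / π * θ = ν * (2 / π * (θ / 2)) := by field_simp
      _ ≤ _ := mul_le_mul_of_nonneg_left this hν0.le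
  set g : ℝ → ℝ := fun θ => (ν / π * θ) ^ (-γ) with hg
  have hgi : ∀ b, IntervalIntegrable g volume 0 b := by
    intro b
    have := (intervalIntegral.intervalIntegrable_rpow' (a := 0) (b := ν / π * b)
      (by linarith : -1 < -γ)).comp_mul_left (c := ν / π)
    have h2 : ν / π * b / (ν / π) = b := by field_simp
    rwa [zero_div, h2] at this
  have hle : ∀ θ, 0 < θ → θ ≤ π → f θ * (ν * sin (θ / 2)) ^ (-γ) ≤ ν * g θ := by
    intro θ h0 h1
    refine mul_le_mul (hfν θ) ?_ (rpow_nonneg ?_ _) hν0.le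
    · exact rpow_le_rpow_of_nonpos (by positivity) (hA θ h0.le h1) (by linarith)
    · exact le_trans (by positivity) (hA θ h0.le h1)
  have hFi : IntervalIntegrable (fun θ => f θ * (ν * sin (θ / 2)) ^ (-γ)) volume 0 π := by
    refine ((hgi π).const_mul ν).mono_fun' ?_ ?_
    · refine (Measurable.aestronglyMeasurable ?_)
      exact hfc.measurable.mul ((by fun_prop : Measurable fun θ => ν * sin (θ / 2)).pow_const _)
    · refine (ae_restrict_iff' measurableSet_uIoc).2 (Eventually.of_forall fun θ hθ => ?_)
      rw [uIoc_of_le pi_pos.le] at hθ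
      have h0 : 0 ≤ f θ * (ν * sin (θ / 2)) ^ (-γ) :=
        mul_nonneg (hf0 θ) (rpow_nonneg (le_trans (mul_nonneg (by positivity) hθ.1.le)
          (hA θ hθ.1.le hθ.2)) _)
      simp only [Real.norm_of_nonneg h0]
      exact hle θ hθ.1 hθ.2
  refine ⟨hFi, ?_⟩
  have hb0 : 0 ≤ π / ν := by positivity
  have hb1 : π / ν ≤ π := div_le_self pi_pos.le hν
  have hmem : π / ν ∈ uIcc 0 π := by rw [uIcc_of_le pi_pos.le]; exact ⟨hb0, hb1⟩
  have hF1 := hFi.mono_set (uIcc_subset_uIcc_left hmem)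
  have hF2 := hFi.mono_set (uIcc_subset_uIcc_right hmem)
  rw [← intervalIntegral.integral_add_adjacent_intervals hF1 hF2]
  refine add_le_add ?_ ?_
  · calc ∫ θ in 0..(π / ν), f θ * (ν * sin (θ / 2)) ^ (-γ)
        ≤ ∫ θ in 0..(π / ν), ν * g θ := by
          refine intervalIntegral.integral_mono_on_of_le_Ioo hb0 hF1 ((hgi _).const_mul ν) ?_
          intro θ hθ
          exact hle θ hθ.1 (hθ.2.le.trans hb1)
      _ = π / (1 - γ) := by
          rw [intervalIntegral.integral_const_mul]
          simp only [hg]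
          rw [intervalIntegral.integral_comp_mul_left (fun x => x ^ (-γ))
            (div_ne_zero hν0.ne' pi_ne_zero), integral_rpow (Or.inl (by linarith)), mul_zero,
            zero_rpow (by linarith), smul_eq_mul]
          have h1 : ν / π * (π / ν) = 1 := by field_simp
          rw [h1, one_rpow, neg_add_eq_sub]
          have : 1 - γ ≠ 0 := by linarith
          field_simp
          ring
  · calc ∫ θ in (π / ν)..π, f θ * (ν * sin (θ / 2)) ^ (-γ)
        ≤ ∫ θ in (π / ν)..π, f θ := by
          refine intervalIntegral.integral_mono_on hb1 hF2 (hfc.intervalIntegrable _ _) ?_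
          intro θ hθ
          refine mul_le_of_le_one_right (hf0 θ) (rpow_le_one_of_one_le_of_nonpos ?_ (by linarith))
          refine le_trans ?_ (hA θ (hb0.trans hθ.1) hθ.2)
          calc (1 : ℝ) = ν / π * (π / ν) := by field_simp
            _ ≤ ν / π * θ := mul_le_mul_of_nonneg_left hθ.1 (by positivity)
      _ ≤ ∫ θ in 0..π, f θ := by
          rw [← intervalIntegral.integral_add_adjacent_intervals
            (hfc.intervalIntegrable 0 (π / ν)) (hfc.intervalIntegrable (π / ν) π)]
          exact le_add_of_nonneg_left (intervalIntegral.integral_nonneg hb0 fun θ _ => hf0 θ)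
      _ ≤ π ^ 2 := integral_inv_one_add_abs_sin_sq_le hν0 hφ

theorem integral_inv_sq_mul_cos_rpow_le {ν : ℝ} (hν : 1 ≤ ν) {γ : ℝ} (hγ0 : 0 ≤ γ) (hγ1 : γ < 1)
    {φ : ℝ} (hφ : φ ∈ Icc 0 π) :
    IntervalIntegrable (fun θ => ν * ((1 + ν * |sin ((θ - φ) / 2)|) ^ 2)⁻¹ *
      (ν * cos (θ / 2)) ^ (-γ)) volume 0 π ∧
    ∫ θ in 0..π, ν * ((1 + ν * |sin ((θ - φ) / 2)|) ^ 2)⁻¹ * (ν * cos (θ / 2)) ^ (-γ)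
      ≤ π / (1 - γ) + π ^ 2 := by
  obtain ⟨h1, h2⟩ := integral_inv_sq_mul_sin_rpow_le hν hγ0 hγ1 (φ := π - φ)
    ⟨by linarith [hφ.2], by linarith [hφ.1]⟩
  have h3 : (fun θ => ν * ((1 + ν * |sin ((θ - φ) / 2)|) ^ 2)⁻¹ * (ν * cos (θ / 2)) ^ (-γ)) =
      fun θ => (fun θ => ν * ((1 + ν * |sin ((θ - (π - φ)) / 2)|) ^ 2)⁻¹ *
        (ν * sin (θ / 2)) ^ (-γ)) (π - θ) := by
    funext θ
    have e1 : (π - θ - (π - φ)) / 2 = -((θ - φ) / 2) := by ring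
    have e2 : (π - θ) / 2 = π / 2 - θ / 2 := by ring
    simp only [e1, e2, sin_neg, abs_neg, sin_pi_div_two_sub]
  rw [h3]
  constructor
  · have := (h1.comp_sub_left π).symm
    simpa using this
  · have h4 := intervalIntegral.integral_comp_sub_left (a := 0) (b := π)
      (fun θ => ν * ((1 + ν * |sin ((θ - (π - φ)) / 2)|) ^ 2)⁻¹ * (ν * sin (θ / 2)) ^ (-γ)) π
    rw [sub_self, sub_zero] at h4
    exact h4.trans_le h2

theorem rpow_le_rpow_mul_of_abs_sub_le {x y d a : ℝ} (hx : 0 < x) (hy : 1 / 15 ≤ y)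
    (hxy : |x - y| ≤ d - 1) (ha : -1 < a) :
    x ^ a ≤ y ^ a * ((16 * d) ^ |a| * (1 + x ^ (-max 0 (-a)))) := by
  have hd : 1 ≤ d := by linarith [abs_nonneg (x - y)]
  have hy0 : 0 < y := by linarith
  rw [abs_le] at hxy
  rcases le_or_gt 0 a with h | h
  · rw [abs_of_nonneg h]
    have h1 : x ^ a ≤ (y * (16 * d)) ^ a := by
      refine rpow_le_rpow hx.le ?_ h
      nlinarith
    rw [mul_rpow hy0.le (by positivity)] at h1
    calc x ^ a ≤ y ^ a * (16 * d) ^ a * 1 := by rwa [mul_one]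
      _ ≤ y ^ a * (16 * d) ^ a * (1 + x ^ (-max 0 (-a))) :=
          mul_le_mul_of_nonneg_left (le_add_of_nonneg_right (by positivity)) (by positivity)
      _ = _ := by ring
  · rw [abs_of_neg h, max_eq_right (by linarith), neg_neg]
    have h1 : y ≤ x * (16 * d * (1 + x⁻¹)) := by
      have : x * (16 * d * (1 + x⁻¹)) = 16 * d * (x + 1) := by field_simp
      rw [this]
      nlinarith
    have h2 := rpow_le_rpow hy0.le h1 (by linarith : 0 ≤ -a)
    rw [mul_rpow hx.le (by positivity), mul_rpow (by positivity) (by positivity)] at h2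
    have h3 : (1 + x⁻¹) ^ (-a) ≤ 1 + x ^ a := by
      have := rpow_add_le_add_rpow (zero_le_one) (inv_pos.2 hx).le (by linarith : 0 ≤ -a)
        (by linarith)
      rwa [one_rpow, inv_rpow hx.le, rpow_neg hx.le, inv_inv] at this
    have hxa : x ^ a * x ^ (-a) = 1 := by rw [← rpow_add hx]; simp
    have hya : y ^ a * y ^ (-a) = 1 := by rw [← rpow_add hy0]; simp
    calc x ^ a = x ^ a * y ^ a * y ^ (-a) := by rw [mul_assoc, hya, mul_one]
      _ ≤ x ^ a * y ^ a * (x ^ (-a) * ((16 * d) ^ (-a) * (1 + x⁻¹) ^ (-a))) :=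
          mul_le_mul_of_nonneg_left h2 (by positivity)
      _ = (x ^ a * x ^ (-a)) * (y ^ a * ((16 * d) ^ (-a) * (1 + x⁻¹) ^ (-a))) := by ring
      _ = y ^ a * ((16 * d) ^ (-a) * (1 + x⁻¹) ^ (-a)) := by rw [hxa, one_mul]
      _ ≤ _ := by gcongr

theorem one_add_rpow_mul_one_add_rpow_le {x y γ δ : ℝ} (hx : 0 < x) (hy : 0 < y)
    (hxy : 1 ≤ x ^ 2 + y ^ 2) (hγ0 : 0 ≤ γ) (hγ1 : γ < 1) (hδ0 : 0 ≤ δ) (hδ1 : δ < 1) :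
    (1 + x ^ (-γ)) * (1 + y ^ (-δ)) ≤ 3 * (2 + x ^ (-γ) + y ^ (-δ)) := by
  have key : ∀ z γ : ℝ, 1 / 2 ≤ z → 0 ≤ γ → γ < 1 → z ^ (-γ) ≤ 2 := by
    intro z γ hz h0 h1
    calc z ^ (-γ) ≤ (1 / 2 : ℝ) ^ (-γ) :=
          rpow_le_rpow_of_nonpos (by norm_num) hz (by linarith)
      _ = 2 ^ γ := by rw [one_div, inv_rpow (by norm_num), rpow_neg (by norm_num), inv_inv]
      _ ≤ 2 ^ (1 : ℝ) := rpow_le_rpow_of_exponent_le (by norm_num) h1.le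
      _ = 2 := rpow_one 2
  have h1 : 0 ≤ x ^ (-γ) := by positivity
  have h2 : 0 ≤ y ^ (-δ) := by positivity
  rcases le_or_gt (1 / 2) x with h | h
  · nlinarith [key x γ h hγ0 hγ1]
  · have : 1 / 2 ≤ y := by nlinarith
    nlinarith [key y δ this hδ0 hδ1]

theorem cos_image_Ioo : cos '' Ioo 0 π = Ioo (-1) 1 := by
  ext t
  constructor
  · rintro ⟨θ, hθ, rfl⟩
    constructor
    · rw [← cos_pi]
      exact strictAntiOn_cos ⟨hθ.1.le, hθ.2.le⟩ ⟨pi_pos.le, le_rfl⟩ hθ.2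
    · rw [← cos_zero]
      exact strictAntiOn_cos ⟨le_rfl, pi_pos.le⟩ ⟨hθ.1.le, hθ.2.le⟩ hθ.1
  · rintro ⟨h1, h2⟩
    exact ⟨arccos t, ⟨arccos_pos.2 h2, arccos_lt_pi.2 h1⟩, cos_arccos h1.le h2.le⟩

theorem integral_Ioo_eq_integral_cos (f : ℝ → ℝ) :
    ∫ t in Ioo (-1 : ℝ) 1, f t = ∫ θ in 0..π, f (cos θ) * sin θ := by
  rw [intervalIntegral.integral_of_le pi_pos.le, integral_Ioc_eq_integral_Ioo, ← cos_image_Ioo,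
    integral_image_eq_integral_abs_deriv_smul measurableSet_Ioo
      (fun θ _ => (hasDerivAt_cos θ).hasDerivWithinAt)
      (injOn_cos.mono Ioo_subset_Icc_self)]
  refine setIntegral_congr_fun measurableSet_Ioo fun θ hθ => ?_
  simp only [smul_eq_mul, abs_neg, abs_of_pos (sin_pos_of_mem_Ioo hθ)]
  ring

theorem IntervalIntegrable.of_integrableOn_cos {f : ℝ → ℝ} (hf : IntegrableOn f (Ioo (-1) 1)) :
    IntervalIntegrable (fun θ => f (cos θ) * sin θ) volume 0 π := by
  rw [intervalIntegrable_iff_integrableOn_Ioo_of_le pi_pos.le]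
  rw [← cos_image_Ioo, integrableOn_image_iff_integrableOn_abs_deriv_smul measurableSet_Ioo
      (fun θ _ => (hasDerivAt_cos θ).hasDerivWithinAt)
      (injOn_cos.mono Ioo_subset_Icc_self)] at hf
  refine hf.congr_fun (fun θ hθ => ?_) measurableSet_Ioo
  simp only [smul_eq_mul, abs_neg, abs_of_pos (sin_pos_of_mem_Ioo hθ)]
  ring

theorem JacobiSystem.integrableOn_jacobiWeight {α β : ℝ} (J : JacobiSystem α β) :
    IntegrableOn (jacobiWeight α β) (Ioo (-1) 1) := by
  have h1 := J.orthonormal 0 0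
  obtain ⟨a, ha⟩ := natDegree_eq_zero.1 (J.natDegree_eq 0)
  have ha0 : a ≠ 0 := by
    rintro rfl
    have := J.leadingCoeff_pos 0
    rw [← ha] at this
    simp at this
  have h2 : IntegrableOn (fun t => (J.P 0).eval t * (J.P 0).eval t * jacobiWeight α β t)
      (Ioo (-1) 1) := by
    refine Integrable.of_integral_ne_zero ?_
    rw [h1]
    simp
  have h3 : IntegrableOn (fun t => (a * a)⁻¹ *
      ((J.P 0).eval t * (J.P 0).eval t * jacobiWeight α β t)) (Ioo (-1) 1) := h2.const_mul _
  convert h3 using 2 with t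
  rw [← ha]
  simp only [eval_C]
  field_simp

theorem jacobiWeight_cos_mul_sin (α β : ℝ) {θ : ℝ} (hθ : θ ∈ Ioo 0 π) :
    jacobiWeight α β (cos θ) * sin θ =
      2 ^ (α + β + 1) * (sin (θ / 2) ^ (2 * α + 1) * cos (θ / 2) ^ (2 * β + 1)) := by
  have hs : 0 < sin (θ / 2) :=
    sin_pos_of_pos_of_lt_pi (by linarith [hθ.1]) (by linarith [hθ.2, pi_pos])
  have hc : 0 < cos (θ / 2) := cos_pos_of_mem_Ioo ⟨by linarith [hθ.1, pi_pos], by linarith [hθ.2]⟩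
  have e0 : θ = 2 * (θ / 2) := by ring
  have e1 : 1 - cos θ = 2 * sin (θ / 2) ^ (2 : ℝ) := by
    rw [e0, cos_two_mul, ← e0, rpow_two, sin_sq]; ring
  have e2 : 1 + cos θ = 2 * cos (θ / 2) ^ (2 : ℝ) := by
    rw [e0, cos_two_mul, ← e0, rpow_two]; ring
  have e3 : sin θ = 2 * sin (θ / 2) * cos (θ / 2) := by
    rw [e0, sin_two_mul, ← e0]
  rw [jacobiWeight, e1, e2, e3, mul_rpow (by norm_num) (by positivity),
    mul_rpow (by norm_num) (by positivity), ← rpow_mul hs.le, ← rpow_mul hc.le,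
    rpow_add hs, rpow_add hc, rpow_add (by norm_num), rpow_add (by norm_num)]
  simp only [rpow_one]
  ring

theorem jacobiWeight_cos_le {α β : ℝ} (hα : -1 < α) (hβ : -1 < β) {ν : ℝ} (hν : 1 ≤ ν) {θ φ : ℝ}
    (hθ : θ ∈ Ioo 0 π) (hφ : φ ∈ Ioo 0 π) (hs : 1 / 15 ≤ ν * sin (φ / 2))
    (hc : 1 / 15 ≤ ν * cos (φ / 2)) :
    jacobiWeight α β (cos θ) * sin θ ≤ jacobiWeight α β (cos φ) * sin φ *
      ((16 * (1 + ν * |sin ((θ - φ) / 2)|)) ^ (|2 * α + 1| + |2 * β + 1|) *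
        (3 * (2 + (ν * sin (θ / 2)) ^ (-max 0 (-(2 * α + 1))) +
          (ν * cos (θ / 2)) ^ (-max 0 (-(2 * β + 1)))))) := by
  have hν0 : 0 < ν := by linarith
  set d := 1 + ν * |sin ((θ - φ) / 2)| with hd
  have hd1 : 1 ≤ d := by rw [hd]; exact le_add_of_nonneg_right (by positivity)
  have hpos : ∀ {t : ℝ}, t ∈ Ioo 0 π → 0 < sin (t / 2) ∧ 0 < cos (t / 2) := fun {t} ht =>
    ⟨sin_pos_of_pos_of_lt_pi (by linarith [ht.1]) (by linarith [ht.2, pi_pos]),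
      cos_pos_of_mem_Ioo ⟨by linarith [ht.1, pi_pos], by linarith [ht.2]⟩⟩
  obtain ⟨hsθ, hcθ⟩ := hpos hθ
  obtain ⟨hsφ, hcφ⟩ := hpos hφ
  set a := 2 * α + 1 with ha
  set b := 2 * β + 1 with hb
  have hrep : ∀ {t : ℝ}, t ∈ Ioo 0 π → jacobiWeight α β (cos t) * sin t =
      2 ^ (α + β + 1) * (ν ^ (a + b))⁻¹ * ((ν * sin (t / 2)) ^ a * (ν * cos (t / 2)) ^ b) := by
    intro t ht
    obtain ⟨h1, h2⟩ := hpos ht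
    have h3 : ν ^ (a + b) ≠ 0 := by positivity
    rw [jacobiWeight_cos_mul_sin α β ht, ← ha, ← hb, mul_rpow hν0.le h1.le, mul_rpow hν0.le h2.le]
    rw [rpow_add hν0] at h3 ⊢
    field_simp
  have e1 : θ / 2 = φ / 2 + (θ - φ) / 2 := by ring
  have e2 : φ / 2 = θ / 2 - (θ - φ) / 2 := by ring
  have hdiff : |sin (θ / 2) - sin (φ / 2)| ≤ |sin ((θ - φ) / 2)| ∧
      |cos (θ / 2) - cos (φ / 2)| ≤ |sin ((θ - φ) / 2)| := by
    have k1 := sin_add (φ / 2) ((θ - φ) / 2)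
    have k2 := sin_sub (θ / 2) ((θ - φ) / 2)
    have k3 := cos_add (φ / 2) ((θ - φ) / 2)
    have k4 := cos_sub (θ / 2) ((θ - φ) / 2)
    rw [← e1] at k1 k3
    rw [← e2] at k2 k4
    set u := sin ((θ - φ) / 2)
    have hv := cos_le_one ((θ - φ) / 2)
    have bound : ∀ z : ℝ, 0 < z → z ≤ 1 → z * u ≤ |u| ∧ -(z * u) ≤ |u| := fun z h0 h1 => by
      constructor <;> cases abs_cases u <;> nlinarith
    have b1 := bound _ hsθ (sin_le_one _)
    have b2 := bound _ hsφ (sin_le_one _)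
    have b3 := bound _ hcθ (cos_le_one _)
    have b4 := bound _ hcφ (cos_le_one _)
    constructor <;> rw [abs_le] <;> constructor <;> nlinarith
  have hsd : |ν * sin (θ / 2) - ν * sin (φ / 2)| ≤ d - 1 := by
    rw [← mul_sub, abs_mul, abs_of_pos hν0, hd, add_sub_cancel_left]
    exact mul_le_mul_of_nonneg_left hdiff.1 hν0.le
  have hcd : |ν * cos (θ / 2) - ν * cos (φ / 2)| ≤ d - 1 := by
    rw [← mul_sub, abs_mul, abs_of_pos hν0, hd, add_sub_cancel_left]
    exact mul_le_mul_of_nonneg_left hdiff.2 hν0.le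
  have h1 := rpow_le_rpow_mul_of_abs_sub_le (mul_pos hν0 hsθ) hs hsd (by linarith : -1 < a)
  have h2 := rpow_le_rpow_mul_of_abs_sub_le (mul_pos hν0 hcθ) hc hcd (by linarith : -1 < b)
  have hsum : 1 ≤ (ν * sin (θ / 2)) ^ 2 + (ν * cos (θ / 2)) ^ 2 := by
    have := sin_sq_add_cos_sq (θ / 2)
    have e : (ν * sin (θ / 2)) ^ 2 + (ν * cos (θ / 2)) ^ 2 = ν ^ 2 := by
      linear_combination ν ^ 2 * this
    rw [e]
    nlinarith
  have h3 := one_add_rpow_mul_one_add_rpow_le (mul_pos hν0 hsθ) (mul_pos hν0 hcθ) hsum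
    (le_max_left 0 (-a)) (max_lt one_pos (by linarith)) (le_max_left 0 (-b))
    (max_lt one_pos (by linarith))
  rw [hrep hθ, hrep hφ, mul_assoc (2 ^ (α + β + 1) * (ν ^ (a + b))⁻¹)]
  refine mul_le_mul_of_nonneg_left ?_ (by positivity)
  have hd0 : 0 < 16 * d := by positivity
  have hAφ : 0 ≤ (ν * sin (φ / 2)) ^ a * (ν * cos (φ / 2)) ^ b := by positivity
  calc (ν * sin (θ / 2)) ^ a * (ν * cos (θ / 2)) ^ b
      ≤ ((ν * sin (φ / 2)) ^ a * ((16 * d) ^ |a| * (1 + (ν * sin (θ / 2)) ^ (-max 0 (-a))))) *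
        ((ν * cos (φ / 2)) ^ b * ((16 * d) ^ |b| * (1 + (ν * cos (θ / 2)) ^ (-max 0 (-b))))) :=
        mul_le_mul h1 h2 (by positivity) (le_trans (by positivity) h1)
    _ = (ν * sin (φ / 2)) ^ a * (ν * cos (φ / 2)) ^ b * ((16 * d) ^ (|a| + |b|) *
        ((1 + (ν * sin (θ / 2)) ^ (-max 0 (-a))) * (1 + (ν * cos (θ / 2)) ^ (-max 0 (-b))))) := by
        rw [rpow_add hd0]; ring
    _ ≤ _ := by gcongr

theorem abs_sin_half_sub_le {θ φ : ℝ} (hθ : θ ∈ Icc 0 π) (hφ : φ ∈ Icc 0 π) :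
    |sin ((θ - φ) / 2)| ≤ |sin ((θ + φ) / 2)| := by
  rw [← sq_le_sq]
  have h1 := sin_nonneg_of_mem_Icc hθ
  have h2 := sin_nonneg_of_mem_Icc hφ
  have h3 : sin ((θ - φ) / 2) ^ 2 = (1 - cos (θ - φ)) / 2 := by
    rw [sin_sq_eq_half_sub, mul_div_cancel₀ _ two_ne_zero]; ring
  have h4 : sin ((θ + φ) / 2) ^ 2 = (1 - cos (θ + φ)) / 2 := by
    rw [sin_sq_eq_half_sub, mul_div_cancel₀ _ two_ne_zero]; ring
  rw [h3, h4, cos_sub, cos_add]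
  nlinarith

theorem eval_add_eval_le {P : ℝ[X]} {L : ℕ} {ν : ℝ} (hν : 0 < ν)
    (hP : ∀ ψ, P.eval (cos ψ) ≤ (2 * L / (1 + ν * |sin (ψ / 2)|)) ^ (2 * L))
    {θ φ : ℝ} (hθ : θ ∈ Icc 0 π) (hφ : φ ∈ Icc 0 π) :
    P.eval (cos (θ - φ)) + P.eval (cos (θ + φ)) ≤
      2 * (2 * L) ^ (2 * L) * ((1 + ν * |sin ((θ - φ) / 2)|) ^ (2 * L))⁻¹ := by
  have h1 := hP (θ - φ)
  have h2 : P.eval (cos (θ + φ)) ≤ (2 * L / (1 + ν * |sin ((θ - φ) / 2)|)) ^ (2 * L) := by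
    refine (hP (θ + φ)).trans ?_
    have := abs_sin_half_sub_le hθ hφ
    gcongr
  rw [div_pow, div_eq_mul_inv] at h1 h2
  linarith

theorem exists_integral_mul_jacobiWeight_le {α β : ℝ} (hα : -1 < α) (hβ : -1 < β)
    (hω : IntervalIntegrable (fun θ => jacobiWeight α β (cos θ) * sin θ) volume 0 π) {L : ℕ}
    (hL : |2 * α + 1| + |2 * β + 1| + 2 ≤ 2 * L) :
    ∃ C : ℝ, ∀ ν : ℝ, 1 ≤ ν → ∀ P : ℝ[X],
      (∀ ψ, P.eval (cos ψ) ≤ (2 * L / (1 + ν * |sin (ψ / 2)|)) ^ (2 * L)) →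
      ∀ φ ∈ Ioo 0 π, 1 / 15 ≤ ν * sin (φ / 2) → 1 / 15 ≤ ν * cos (φ / 2) →
      ν * ∫ θ in 0..π, (P.eval (cos (θ - φ)) + P.eval (cos (θ + φ))) *
          (jacobiWeight α β (cos θ) * sin θ)
        ≤ C * (jacobiWeight α β (cos φ) * sin φ) := by
  set a := 2 * α + 1 with ha
  set b := 2 * β + 1 with hb
  set γ := max 0 (-a) with hγ
  set δ := max 0 (-b) with hδ
  set K : ℝ := 2 * (2 * L) ^ (2 * L) * (16 ^ (|a| + |b|) * 3) with hK
  refine ⟨K * (2 * (π / (1 - 0) + π ^ 2) + (π / (1 - γ) + π ^ 2) + (π / (1 - δ) + π ^ 2)), ?_⟩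
  intro ν hν P hP φ hφ hs hc
  have hν0 : 0 < ν := by linarith
  have hφ' := Ioo_subset_Icc_self hφ
  obtain ⟨i0, b0⟩ := integral_inv_sq_mul_sin_rpow_le hν le_rfl one_pos hφ'
  obtain ⟨i1, b1⟩ := integral_inv_sq_mul_sin_rpow_le hν (le_max_left 0 (-a) : 0 ≤ γ)
    (max_lt one_pos (by linarith)) hφ'
  obtain ⟨i2, b2⟩ := integral_inv_sq_mul_cos_rpow_le hν (le_max_left 0 (-b) : 0 ≤ δ)
    (max_lt one_pos (by linarith)) hφ'
  set F0 : ℝ → ℝ := fun θ => ν * ((1 + ν * |sin ((θ - φ) / 2)|) ^ 2)⁻¹ *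
      (ν * sin (θ / 2)) ^ (-(0 : ℝ)) with hF0
  set F1 : ℝ → ℝ := fun θ => ν * ((1 + ν * |sin ((θ - φ) / 2)|) ^ 2)⁻¹ *
      (ν * sin (θ / 2)) ^ (-γ) with hF1
  set F2 : ℝ → ℝ := fun θ => ν * ((1 + ν * |sin ((θ - φ) / 2)|) ^ 2)⁻¹ *
      (ν * cos (θ / 2)) ^ (-δ) with hF2
  set W := jacobiWeight α β (cos φ) * sin φ with hW
  have hW0 : 0 ≤ W := by
    have h1 := cos_le_one φ
    have h2 := neg_one_le_cos φ
    exact mul_nonneg (mul_nonneg (rpow_nonneg (by linarith) _) (rpow_nonneg (by linarith) _))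
      (sin_nonneg_of_mem_Icc hφ')
  have hInt : IntervalIntegrable (fun θ => (P.eval (cos (θ - φ)) + P.eval (cos (θ + φ))) *
      (jacobiWeight α β (cos θ) * sin θ)) volume 0 π :=
    hω.continuousOn_mul (Continuous.continuousOn (by fun_prop))
  rw [← intervalIntegral.integral_const_mul]
  calc ∫ θ in 0..π, ν * ((P.eval (cos (θ - φ)) + P.eval (cos (θ + φ))) *
          (jacobiWeight α β (cos θ) * sin θ))
      ≤ ∫ θ in 0..π, K * W * (2 * F0 θ + F1 θ + F2 θ) := by
        refine intervalIntegral.integral_mono_on_of_le_Ioo pi_pos.le (hInt.const_mul ν)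
          ((((i0.const_mul 2).add i1).add i2).const_mul _) fun θ hθ => ?_
        have hS := eval_add_eval_le hν0 hP (Ioo_subset_Icc_self hθ) hφ'
        have hw := jacobiWeight_cos_le hα hβ hν hθ hφ hs hc
        have hw0 : 0 ≤ jacobiWeight α β (cos θ) * sin θ := by
          have h1 := cos_le_one θ
          have h2 := neg_one_le_cos θ
          exact mul_nonneg (mul_nonneg (rpow_nonneg (by linarith) _)
            (rpow_nonneg (by linarith) _)) (sin_nonneg_of_mem_Icc (Ioo_subset_Icc_self hθ))
        rw [← ha, ← hb, ← hγ, ← hδ, ← hW] at hw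
        simp only [hF0, hF1, hF2, neg_zero, rpow_zero, mul_one]
        set d := 1 + ν * |sin ((θ - φ) / 2)| with hd
        have hd1 : 1 ≤ d := by rw [hd]; exact le_add_of_nonneg_right (by positivity)
        have hd0 : 0 < d := by linarith
        have hsθ : 0 < sin (θ / 2) :=
          sin_pos_of_pos_of_lt_pi (by linarith [hθ.1]) (by linarith [hθ.2, pi_pos])
        have hcθ : 0 < cos (θ / 2) :=
          cos_pos_of_mem_Ioo ⟨by linarith [hθ.1, pi_pos], by linarith [hθ.2]⟩
        have hdd : (d ^ (2 * L))⁻¹ * (16 * d) ^ (|a| + |b|) ≤ 16 ^ (|a| + |b|) * (d ^ 2)⁻¹ := by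
          rw [mul_rpow (by norm_num) hd0.le, inv_mul_le_iff₀ (by positivity)]
          have h1 : d ^ (|a| + |b|) * d ^ 2 ≤ d ^ (2 * L) := by
            rw [← rpow_two, ← rpow_natCast d (2 * L), ← rpow_add hd0]
            refine rpow_le_rpow_of_exponent_le hd1 ?_
            push_cast
            exact hL
          rw [← le_div_iff₀ (by positivity)] at h1
          calc (16 : ℝ) ^ (|a| + |b|) * d ^ (|a| + |b|)
              ≤ 16 ^ (|a| + |b|) * (d ^ (2 * L) / d ^ 2) := by gcongr
            _ = _ := by ring
        set A := (ν * sin (θ / 2)) ^ (-γ)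
        set B := (ν * cos (θ / 2)) ^ (-δ)
        have hA : 0 ≤ A := by positivity
        have hB : 0 ≤ B := by positivity
        calc ν * ((P.eval (cos (θ - φ)) + P.eval (cos (θ + φ))) *
              (jacobiWeight α β (cos θ) * sin θ))
            ≤ ν * ((2 * (2 * L) ^ (2 * L) * (d ^ (2 * L))⁻¹) *
              (W * ((16 * d) ^ (|a| + |b|) * (3 * (2 + A + B))))) := by
              refine mul_le_mul_of_nonneg_left ?_ hν0.le
              exact mul_le_mul hS hw hw0 (by positivity)
          _ = ν * (2 * (2 * L) ^ (2 * L)) * W * (3 * (2 + A + B)) *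
              ((d ^ (2 * L))⁻¹ * (16 * d) ^ (|a| + |b|)) := by ring
          _ ≤ ν * (2 * (2 * L) ^ (2 * L)) * W * (3 * (2 + A + B)) *
              (16 ^ (|a| + |b|) * (d ^ 2)⁻¹) :=
              mul_le_mul_of_nonneg_left hdd (by positivity)
          _ = _ := by rw [hK]; ring
    _ = K * W * (2 * (∫ θ in 0..π, F0 θ) + (∫ θ in 0..π, F1 θ) + ∫ θ in 0..π, F2 θ) := by
        rw [intervalIntegral.integral_const_mul,
          intervalIntegral.integral_add ((i0.const_mul 2).add i1) i2,
          intervalIntegral.integral_add (i0.const_mul 2) i1, intervalIntegral.integral_const_mul]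
    _ ≤ K * W * (2 * (π / (1 - 0) + π ^ 2) + (π / (1 - γ) + π ^ 2) + (π / (1 - δ) + π ^ 2)) := by
        refine mul_le_mul_of_nonneg_left ?_ (by positivity)
        linarith
    _ = _ := by ring

theorem abs_sin_natCast_mul_le (k : ℕ) (x : ℝ) : |sin (k * x)| ≤ k * |sin x| := by
  induction k with
  | zero => simp
  | succ k ih =>
    have h : ((k + 1 : ℕ) : ℝ) * x = k * x + x := by push_cast; ring
    rw [h, sin_add]
    refine (abs_add_le _ _).trans ?_
    rw [abs_mul, abs_mul]
    have h1 := abs_cos_le_one x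
    have h2 := abs_cos_le_one (k * x)
    have h3 := abs_nonneg (sin x)
    have h4 := abs_nonneg (sin (k * x))
    push_cast
    nlinarith

theorem half_le_of_cos_two_mul_neg {k : ℕ} {x : ℝ} (h : cos (k * (2 * x)) < 0) :
    1 / 2 ≤ (k * sin x) ^ 2 := by
  have h1 : cos (k * (2 * x)) = 1 - 2 * sin (k * x) ^ 2 := by
    rw [show (k : ℝ) * (2 * x) = 2 * (k * x) by ring, cos_two_mul, cos_sq']
    ring
  have h2 : sin (k * x) ^ 2 ≤ (k * sin x) ^ 2 := by
    rw [sq_le_sq, abs_mul, Nat.abs_cast]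
    exact abs_sin_natCast_mul_le k x
  linarith

theorem le_of_cutoff_ne_zero {n : ℕ} {φ : ℝ} (hφ : φ ∈ Ioo 0 π)
    (h : cutoff (10 * (n + 1)) φ ≠ 0) :
    1 / 15 ≤ ((n : ℝ) + 1) * sin (φ / 2) ∧ 1 / 15 ≤ ((n : ℝ) + 1) * cos (φ / 2) := by
  have hneg : cos ((10 * (n + 1) : ℕ) * φ) < 0 := by
    by_contra! h0
    exact h (max_eq_left (by linarith))
  have hs : 0 < sin (φ / 2) :=
    sin_pos_of_pos_of_lt_pi (by linarith [hφ.1]) (by linarith [hφ.2, pi_pos])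
  have hc : 0 < cos (φ / 2) :=
    cos_pos_of_mem_Ioo ⟨by linarith [hφ.1, pi_pos], by linarith [hφ.2]⟩
  have key : ∀ s : ℝ, 0 < s → 1 / 2 ≤ ((10 * (n + 1) : ℕ) * s) ^ 2 →
      1 / 15 ≤ ((n : ℝ) + 1) * s := by
    intro s hs h
    refine le_of_sq_le_sq ?_ (by positivity)
    push_cast at h
    nlinarith
  refine ⟨key _ hs (half_le_of_cos_two_mul_neg ?_), key _ hc ?_⟩
  · rwa [mul_div_cancel₀ _ two_ne_zero]
  · rw [← sin_pi_div_two_sub]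
    refine half_le_of_cos_two_mul_neg ?_
    have e : ((10 * (n + 1) : ℕ) : ℝ) * (2 * (π / 2 - φ / 2)) =
        (5 * (n + 1) : ℕ) * (2 * π) - (10 * (n + 1) : ℕ) * φ := by push_cast; ring
    rwa [e, cos_nat_mul_two_pi_sub]

theorem rpow_le_mul_integral_of_le {y k : ℝ → ℝ} (hy : Continuous y) (hk : Continuous k)
    (hy0 : ∀ φ, 0 ≤ y φ) (hk0 : ∀ φ, 0 ≤ k φ) {Z : ℝ} (hZ : 0 < Z) (hkZ : ∫ φ in 0..π, k φ ≤ Z)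
    {p : ℝ} (hp : 1 ≤ p) {m : ℝ} (hm0 : 0 ≤ m) (hm : m ≤ ∫ φ in 0..π, y φ * k φ) :
    m ^ p ≤ Z ^ (p - 1) * ∫ φ in 0..π, y φ ^ p * k φ := by
  have hyp : Continuous fun φ => y φ ^ p := hy.rpow_const fun _ => Or.inr (by linarith)
  rcases hm0.eq_or_lt with rfl | hm0
  · rw [zero_rpow (by linarith)]
    refine mul_nonneg (by positivity) (intervalIntegral.integral_nonneg pi_pos.le fun φ _ => ?_)
    exact mul_nonneg (rpow_nonneg (hy0 φ) _) (hk0 φ)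
  set a := m / Z with ha
  have ha0 : 0 < a := by positivity
  have hmZ : m = a * Z := by rw [ha]; field_simp
  have tangent : ∀ φ, a ^ p * (1 - p) * k φ + a ^ p * p / a * (y φ * k φ) ≤ y φ ^ p * k φ := by
    intro φ
    have h1 := one_add_mul_self_le_rpow_one_add (s := y φ / a - 1)
      (by have := div_nonneg (hy0 φ) ha0.le; linarith) hp
    rw [add_sub_cancel, div_rpow (hy0 φ) ha0.le, le_div_iff₀ (by positivity)] at h1
    have h2 := mul_le_mul_of_nonneg_right h1 (hk0 φ)
    refine le_trans (le_of_eq ?_) h2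
    field_simp
    ring
  have hInt : ∫ φ in 0..π, (a ^ p * (1 - p) * k φ + a ^ p * p / a * (y φ * k φ)) ≤
      ∫ φ in 0..π, y φ ^ p * k φ :=
    intervalIntegral.integral_mono_on pi_pos.le (Continuous.intervalIntegrable (by fun_prop) _ _)
      ((hyp.mul hk).intervalIntegrable _ _) fun φ _ => tangent φ
  rw [intervalIntegral.integral_add (Continuous.intervalIntegrable (by fun_prop) _ _)
    (Continuous.intervalIntegrable (by fun_prop) _ _), intervalIntegral.integral_const_mul,
    intervalIntegral.integral_const_mul] at hInt
  have hap : 0 < a ^ p := by positivity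
  have h1 : a ^ p * (1 - p) * Z ≤ a ^ p * (1 - p) * ∫ φ in 0..π, k φ :=
    mul_le_mul_of_nonpos_left hkZ (mul_nonpos_of_nonneg_of_nonpos hap.le (by linarith))
  have h2 : a ^ p * p / a * (a * Z) ≤ a ^ p * p / a * ∫ φ in 0..π, y φ * k φ := by
    rw [← hmZ]
    exact mul_le_mul_of_nonneg_left hm (by positivity)
  have h3 : a ^ p * (1 - p) * Z + a ^ p * p / a * (a * Z) = a ^ p * Z := by
    field_simp
    ring
  calc m ^ p = Z ^ (p - 1) * (a ^ p * Z) := by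
        rw [hmZ, mul_rpow ha0.le hZ.le, rpow_sub_one hZ.ne']
        field_simp
    _ ≤ _ := mul_le_mul_of_nonneg_left (by linarith) (by positivity)

theorem integral_localizing_kernel_le {P : ℝ[X]} {L : ℕ} (hL : 1 ≤ L) {n : ℕ}
    (hP : ∀ ψ, P.eval (cos ψ) ≤ (2 * L / (1 + (n + 1) * |sin (ψ / 2)|)) ^ (2 * L))
    (hP0 : ∀ t, 0 ≤ P.eval t) {θ : ℝ} (hθ : θ ∈ Icc 0 π) :
    ∫ φ in 0..π, 8 * (n + 1) * cutoff (10 * (n + 1)) φ *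
        (P.eval (cos (θ - φ)) + P.eval (cos (θ + φ))) ≤ 16 * (2 * L) ^ (2 * L) * π ^ 2 := by
  have hcont := continuous_cutoff (10 * (n + 1))
  have hν : (0 : ℝ) < n + 1 := by positivity
  calc ∫ φ in 0..π, 8 * (n + 1) * cutoff (10 * (n + 1)) φ *
        (P.eval (cos (θ - φ)) + P.eval (cos (θ + φ)))
      ≤ ∫ φ in 0..π, (16 : ℝ) * (2 * L) ^ (2 * L) *
          ((n + 1) * ((1 + (n + 1) * |sin ((φ - θ) / 2)|) ^ 2)⁻¹) := by
        refine intervalIntegral.integral_mono_on pi_pos.le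
          (Continuous.intervalIntegrable (by fun_prop) _ _)
          (Continuous.intervalIntegrable ?_ _ _) fun φ hφ => ?_
        · refine continuous_const.mul (continuous_const.mul (Continuous.inv₀ (by fun_prop) ?_))
          intro φ
          positivity
        · have h1 := eval_add_eval_le hν hP hθ hφ
          have e : |sin ((φ - θ) / 2)| = |sin ((θ - φ) / 2)| := by
            rw [← abs_neg, ← sin_neg]
            ring_nf
          rw [e]
          set d : ℝ := 1 + (n + 1) * |sin ((θ - φ) / 2)| with hd
          have hd1 : 1 ≤ d := by rw [hd]; exact le_add_of_nonneg_right (by positivity)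
          have h2 : (d ^ (2 * L))⁻¹ ≤ (d ^ 2)⁻¹ :=
            inv_anti₀ (by positivity) (pow_le_pow_right₀ hd1 (by omega))
          have h3 := cutoff_le_one (10 * (n + 1)) φ
          have h4 := cutoff_nonneg (10 * (n + 1)) φ
          have h5 : 0 ≤ P.eval (cos (θ - φ)) + P.eval (cos (θ + φ)) :=
            add_nonneg (hP0 _) (hP0 _)
          calc 8 * (n + 1) * cutoff (10 * (n + 1)) φ *
                (P.eval (cos (θ - φ)) + P.eval (cos (θ + φ)))
              ≤ 8 * (n + 1) * 1 * (2 * (2 * L) ^ (2 * L) * (d ^ 2)⁻¹) := by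
                gcongr
                exact h1.trans (by gcongr)
            _ = _ := by ring
    _ ≤ _ := by
        rw [intervalIntegral.integral_const_mul]
        exact mul_le_mul_of_nonneg_left (integral_inv_one_add_abs_sin_sq_le hν hθ) (by positivity)

theorem JacobiNodes.sum_wt_mul_eval_add_eval {α β : ℝ} {J : JacobiSystem α β} (N : JacobiNodes J)
    {n : ℕ} {P : ℝ[X]} (hP : P.natDegree ≤ 2 * n) (φ : ℝ) :
    ∑ j, N.wt n j * (P.eval (cos (arccos (N.node n j) - φ)) +
        P.eval (cos (arccos (N.node n j) + φ))) =
      ∫ θ in 0..π, (P.eval (cos (θ - φ)) + P.eval (cos (θ + φ))) *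
          (jacobiWeight α β (cos θ) * sin θ) := by
  obtain ⟨Q, hQ, hQe⟩ := exists_symmetrized P φ
  have h := N.quadrature n Q (by omega)
  rw [integral_Ioo_eq_integral_cos] at h
  simp only [← hQe, ← mul_assoc]
  rw [h]
  refine Finset.sum_congr rfl fun j _ => ?_
  rw [cos_arccos (N.node_mem n j).1.le (N.node_mem n j).2.le]

theorem JacobiNodes.exists_sum_le_integral {α β : ℝ} (hα : -1 < α) (hβ : -1 < β)
    {J : JacobiSystem α β} (N : JacobiNodes J) : ∃ Z C : ℝ, 0 < Z ∧ 0 ≤ C ∧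
      ∀ (X : Type*) [NormedAddCommGroup X] [NormedSpace ℝ X] [CompleteSpace X],
      ∀ p : ℝ, 1 ≤ p → ∀ n : ℕ, ∀ x : ℕ → X,
      ∑ j, N.wt n j * ‖∑ k ∈ Finset.range (2 * n + 1), (N.node n j) ^ k • x k‖ ^ p
        ≤ Z ^ (p - 1) * (C * ∫ t in Ioo (-1 : ℝ) 1,
            ‖∑ k ∈ Finset.range (2 * n + 1), t ^ k • x k‖ ^ p * jacobiWeight α β t) := by
  have hω := IntervalIntegrable.of_integrableOn_cos J.integrableOn_jacobiWeight
  obtain ⟨L, hL1, hL⟩ : ∃ L : ℕ, 1 ≤ L ∧ |2 * α + 1| + |2 * β + 1| + 2 ≤ 2 * (L : ℝ) := by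
    refine ⟨⌈|2 * α + 1| + |2 * β + 1|⌉₊ + 1, by omega, ?_⟩
    have := Nat.le_ceil (|2 * α + 1| + |2 * β + 1|)
    have h0 : 0 ≤ |2 * α + 1| + |2 * β + 1| := by positivity
    push_cast
    linarith
  obtain ⟨C, hC⟩ := exists_integral_mul_jacobiWeight_le hα hβ hω hL
  have hL0 : (0 : ℝ) < L := by exact_mod_cast hL1
  refine ⟨16 * (2 * L) ^ (2 * L) * π ^ 2, 8 * max C 0, by positivity, by positivity, ?_⟩
  intro X _ _ _ p hp n x
  obtain ⟨P, hPdeg, hP1, hP0, hP⟩ := exists_localized_polynomial hL1 n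
  set Z : ℝ := 16 * (2 * L) ^ (2 * L) * π ^ 2 with hZ
  set h : ℝ → ℝ := cutoff (10 * (n + 1)) with hh
  have hhc : Continuous h := continuous_cutoff _
  set S : ℝ → ℝ → ℝ := fun θ φ => P.eval (cos (θ - φ)) + P.eval (cos (θ + φ)) with hS
  have hS0 : ∀ θ φ, 0 ≤ S θ φ := fun θ φ => add_nonneg (hP0 _) (hP0 _)
  set y : ℝ → ℝ := fun φ => ‖∑ k ∈ Finset.range (2 * n + 1), cos φ ^ k • x k‖ with hy
  have hyc : Continuous y := by fun_prop
  have hypc : Continuous fun φ => y φ ^ p := hyc.rpow_const fun _ => Or.inr (by linarith)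
  set θ : Fin (n + 1) → ℝ := fun j => arccos (N.node n j) with hθ
  have hcosθ : ∀ j, cos (θ j) = N.node n j := fun j =>
    cos_arccos (N.node_mem n j).1.le (N.node_mem n j).2.le
  have hker : ∀ j, Continuous fun φ => 8 * (n + 1) * h φ * S (θ j) φ := fun j => by
    simp only [hS]; fun_prop
  rw [integral_Ioo_eq_integral_cos]
  calc ∑ j, N.wt n j * ‖∑ k ∈ Finset.range (2 * n + 1), (N.node n j) ^ k • x k‖ ^ p
      ≤ ∑ j, N.wt n j * (Z ^ (p - 1) * ∫ φ in 0..π, y φ ^ p *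
          (8 * (n + 1) * h φ * S (θ j) φ)) := by
        refine Finset.sum_le_sum fun j _ => mul_le_mul_of_nonneg_left ?_ (N.wt_pos n j).le
        have := rpow_le_mul_integral_of_le hyc (hker j) (fun φ => norm_nonneg _)
          (fun φ => mul_nonneg (mul_nonneg (by positivity) (cutoff_nonneg _ _)) (hS0 _ _))
          (by positivity : 0 < Z)
          (integral_localizing_kernel_le hL1 hP hP0 ⟨arccos_nonneg _, arccos_le_pi _⟩) hp
          (norm_nonneg _) (norm_le_integral_cutoff x P hPdeg hP1 hP0 (θ j))
        rwa [hcosθ] at this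
    _ = Z ^ (p - 1) * ∫ φ in 0..π, y φ ^ p * (8 * h φ) *
          ((n + 1) * ∑ j, N.wt n j * S (θ j) φ) := by
        simp only [mul_left_comm _ (Z ^ (p - 1))]
        rw [← Finset.mul_sum]
        congr 1
        simp only [← intervalIntegral.integral_const_mul]
        have hi : ∀ j ∈ Finset.univ, IntervalIntegrable
            (fun φ => N.wt n j * (y φ ^ p * (8 * (n + 1) * h φ * S (θ j) φ))) volume 0 π :=
          fun j _ => (continuous_const.mul (hypc.mul (hker j))).intervalIntegrable _ _
        rw [← intervalIntegral.integral_finsetSum hi]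
        refine intervalIntegral.integral_congr fun φ _ => ?_
        simp only [Finset.mul_sum]
        refine Finset.sum_congr rfl fun j _ => ?_
        ring
    _ ≤ Z ^ (p - 1) * ∫ φ in 0..π, 8 * max C 0 *
          (y φ ^ p * (jacobiWeight α β (cos φ) * sin φ)) := by
        refine mul_le_mul_of_nonneg_left ?_ (by positivity)
        refine intervalIntegral.integral_mono_on_of_le_Ioo pi_pos.le
          (Continuous.intervalIntegrable (by simp only [hS]; fun_prop) _ _)
          ((hω.continuousOn_mul hypc.continuousOn).const_mul _) fun φ hφ => ?_
        have hw0 : 0 ≤ jacobiWeight α β (cos φ) * sin φ := by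
          have h1 := cos_le_one φ
          have h2 := neg_one_le_cos φ
          exact mul_nonneg (mul_nonneg (rpow_nonneg (by linarith) _)
            (rpow_nonneg (by linarith) _)) (sin_nonneg_of_mem_Icc (Ioo_subset_Icc_self hφ))
        have hyp0 : 0 ≤ y φ ^ p := rpow_nonneg (norm_nonneg _) _
        have hM : 0 ≤ max C 0 * (jacobiWeight α β (cos φ) * sin φ) :=
          mul_nonneg (le_max_right _ _) hw0
        by_cases h0 : h φ = 0
        · rw [h0, mul_zero, mul_zero, zero_mul]
          positivity
        obtain ⟨hs, hc⟩ := le_of_cutoff_ne_zero hφ h0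
        have h1 := hC (n + 1) (by simp) P hP φ hφ hs hc
        have h2 : ((n : ℝ) + 1) * ∑ j, N.wt n j * S (θ j) φ ≤
            max C 0 * (jacobiWeight α β (cos φ) * sin φ) := by
          simp only [hS, hθ]
          rw [N.sum_wt_mul_eval_add_eval hPdeg]
          exact h1.trans (mul_le_mul_of_nonneg_right (le_max_left _ _) hw0)
        have h3 : h φ ≤ 1 := cutoff_le_one _ _
        have h4 : 0 ≤ h φ := cutoff_nonneg _ _
        calc y φ ^ p * (8 * h φ) * ((n + 1) * ∑ j, N.wt n j * S (θ j) φ)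
            ≤ y φ ^ p * (8 * h φ) * (max C 0 * (jacobiWeight α β (cos φ) * sin φ)) :=
              mul_le_mul_of_nonneg_left h2 (by positivity)
          _ ≤ y φ ^ p * (8 * 1) * (max C 0 * (jacobiWeight α β (cos φ) * sin φ)) := by
              gcongr
          _ = _ := by ring
    _ = _ := by
        rw [intervalIntegral.integral_const_mul]
        simp only [hy, mul_assoc]

theorem rpow_one_div_le_of_le {Z C : ℝ} (hZ : 0 < Z) {s I p : ℝ} (hp : 1 ≤ p)
    (hs : 0 ≤ s) (hI : 0 ≤ I) (h : s ≤ Z ^ (p - 1) * (C * I)) :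
    (max Z C)⁻¹ * s ^ (1 / p) ≤ I ^ (1 / p) := by
  set c := max Z C with hc
  have hc0 : 0 < c := lt_max_of_lt_left hZ
  have h1 : s ≤ c ^ p * I := by
    calc s ≤ Z ^ (p - 1) * (C * I) := h
      _ ≤ c ^ (p - 1) * (c * I) := by
          have := le_max_left Z C
          have h2 := le_max_right Z C
          have h3 : Z ^ (p - 1) ≤ c ^ (p - 1) := rpow_le_rpow hZ.le this (by linarith)
          exact (mul_le_mul_of_nonneg_left (mul_le_mul_of_nonneg_right h2 hI)
            (by positivity)).trans (mul_le_mul_of_nonneg_right h3 (by positivity))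
      _ = c ^ p * I := by rw [← mul_assoc, ← rpow_add_one hc0.ne', sub_add_cancel]
  rw [inv_mul_le_iff₀ hc0]
  calc s ^ (1 / p) ≤ (c ^ p * I) ^ (1 / p) := rpow_le_rpow hs h1 (by positivity)
    _ = c * I ^ (1 / p) := by
        rw [mul_rpow (by positivity) hI, ← rpow_mul hc0.le, mul_one_div_cancel (by linarith),
          rpow_one]

end

/-- Theorem 1 (a): the left Marcinkiewicz-Zygmund interpolation inequality for
`X`-valued polynomials of degree `≤ 2n` at the Jacobi nodes, with a constant `c`
depending only on `α, β` (in particular not on the Banach space `X`, the exponent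
`1 ≤ p < ∞`, nor on `n`). -/
theorem marcinkiewicz_zygmund_left.{u}
    (α β : ℝ) (hα : -1 < α) (hβ : -1 < β)
    (J : JacobiSystem α β) (N : JacobiNodes J) :
    ∃ c : ℝ, 0 < c ∧
      ∀ (X : Type u) [NormedAddCommGroup X] [NormedSpace ℝ X] [CompleteSpace X],
      ∀ p : ℝ, 1 ≤ p → ∀ n : ℕ, ∀ x : ℕ → X,
      c⁻¹ * (∑ j : Fin (n + 1), N.wt n j *
          ‖∑ k ∈ Finset.range (2 * n + 1), (N.node n j) ^ k • x k‖ ^ p) ^ (1 / p)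
        ≤ (∫ t in Ioo (-1:ℝ) 1,
            ‖∑ k ∈ Finset.range (2 * n + 1), t ^ k • x k‖ ^ p * jacobiWeight α β t) ^ (1 / p) := by

  obtain ⟨Z, C, hZ, hC, h⟩ := N.exists_sum_le_integral hα hβ
  refine ⟨max Z C, lt_max_of_lt_left hZ, fun X _ _ _ p hp n x => ?_⟩
  refine rpow_one_div_le_of_le hZ hp ?_ ?_ (h X p hp n x)
  · exact Finset.sum_nonneg fun j _ =>
      mul_nonneg (N.wt_pos n j).le (Real.rpow_nonneg (norm_nonneg _) _)
  · refine setIntegral_nonneg measurableSet_Ioo fun t ht => mul_nonneg ?_ (mul_nonneg ?_ ?_)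
    · exact Real.rpow_nonneg (norm_nonneg _) _
    · exact Real.rpow_nonneg (by linarith [ht.2]) _
    · exact Real.rpow_nonneg (by linarith [ht.1]) _
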